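/- arXiv:math/0302276 — 4 statements merged into one kernel-verified Lean document; each statement's English description precedes it below -/
import Mathlib

section
/- If r is a complex number that is not a rational number, then there exists a field automorphism g : ℂ → ℂ such that g(r) ≠ r. -/
/-- A permutation of a transcendence basis of an algebraically closed field, together with an
automorphism of the base ring, extends to an automorphism of the field. -/
theorem IsTranscendenceBasis.exists_ringEquiv {R K ι : Type*} [CommRing R] [Field K] [Algebra R K]
    [IsAlgClosed K] {v : ι → K} (hv : IsTranscendenceBasis R v) (σ : R ≃+* R)
    (e : Equiv.Perm ι) :
    ∃ g : K ≃+* K, (∀ a, g (algebraMap R K a) = algebraMap R K (σ a)) ∧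
      ∀ i, g (v i) = v (e i) := by
  have := IsAlgClosed.isAlgClosure_of_transcendence_basis v hv
  let f : Algebra.adjoin R (Set.range v) ≃+* Algebra.adjoin R (Set.range v) :=
    hv.1.aevalEquiv.symm.toRingEquiv.trans <| (MvPolynomial.mapEquiv ι σ).trans <|
      (MvPolynomial.renameEquiv R e).toRingEquiv.trans hv.1.aevalEquiv.toRingEquiv
  have hf (p : MvPolynomial ι R) : IsAlgClosure.equivOfEquiv K K f (MvPolynomial.aeval v p) =
      MvPolynomial.aeval v (MvPolynomial.rename e (MvPolynomial.map (σ : R →+* R) p)) := by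
    rw [← hv.1.algebraMap_aevalEquiv, IsAlgClosure.equivOfEquiv_algebraMap,
      ← hv.1.algebraMap_aevalEquiv]
    simp [f]
  refine ⟨IsAlgClosure.equivOfEquiv K K f, fun a ↦ ?_, fun i ↦ ?_⟩
  · simpa using hf (MvPolynomial.C a)
  · simpa using hf (MvPolynomial.X i)

theorem IsAlgebraic.exists_ringEquiv_ne {F K : Type*} [Field F] [PerfectField F] [Field K]
    [Algebra F K] [IsAlgClosed K] {r : K} (h : IsAlgebraic F r)
    (hr : r ∉ Set.range (algebraMap F K)) : ∃ g : K ≃+* K, g r ≠ r := by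
  let x : algebraicClosure F K := ⟨r, mem_algebraicClosure_iff.2 h⟩
  have : Normal F (algebraicClosure F K) := IsAlgClosure.normal F _
  have : IsGalois F (algebraicClosure F K) := ⟨⟩
  have hx : x ∉ Set.range (algebraMap F (algebraicClosure F K)) := by
    rintro ⟨q, hq⟩
    exact hr ⟨q, congrArg Subtype.val hq⟩
  rw [InfiniteGalois.mem_range_algebraMap_iff_fixed] at hx
  push Not at hx
  obtain ⟨σ, hσ⟩ := hx
  obtain ⟨s, hs⟩ := exists_isTranscendenceBasis (algebraicClosure F K) K
  obtain ⟨g, hg, -⟩ := hs.exists_ringEquiv σ.toRingEquiv (Equiv.refl _)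
  exact ⟨g, fun hgr ↦ hσ (Subtype.ext ((hg x).symm.trans hgr))⟩

theorem Complex.exists_ringEquiv_ne_of_transcendental {r : ℂ} (h : Transcendental ℚ r) :
    ∃ g : ℂ ≃+* ℂ, g r ≠ r := by
  have hr : AlgebraicIndepOn ℚ id ({r} : Set ℂ) :=
    (algebraicIndependent_singleton_iff (⟨r, rfl⟩ : ({r} : Set ℂ))).2 h
  obtain ⟨s, hrs, hs⟩ := exists_isTranscendenceBasis_superset hr
  have hcard := IsAlgClosed.cardinal_eq_cardinal_transcendence_basis_of_aleph0_lt' _ hs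
    Cardinal.mkRat.le (by rw [Cardinal.mk_complex]; exact Cardinal.aleph0_lt_continuum)
  have : Infinite s := by
    rw [Cardinal.infinite_iff, ← hcard, Cardinal.mk_complex]
    exact Cardinal.aleph0_le_continuum
  let a : s := ⟨r, hrs rfl⟩
  obtain ⟨b, hb⟩ := exists_ne a
  obtain ⟨g, -, hg⟩ := hs.exists_ringEquiv (RingEquiv.refl ℚ) (Equiv.swap a b)
  refine ⟨g, fun hgr ↦ hb (Subtype.ext ?_)⟩
  simpa [a, hgr] using (hg a).symm

/-- If `r` is a complex number that is not rational, then there exists a field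
automorphism `g : ℂ → ℂ` such that `g r ≠ r`. -/
theorem stmt0 (r : ℂ) (hr : ¬ ∃ q : ℚ, (q : ℂ) = r) :
    ∃ g : ℂ ≃+* ℂ, g r ≠ r := by
  by_cases h : IsAlgebraic ℚ r
  · exact h.exists_ringEquiv_ne (by simpa using hr)
  · exact Complex.exists_ringEquiv_ne_of_transcendental h
end

section
/- Let n ≥ 1. If x, y ∈ ℝⁿ and |x−y|² is not a rational number, then there exists a map f : ℝⁿ → ℂⁿ that preserves all distances √r with rational r ≥ 0 but does not preserve the distance between x and y; that is, φₙ(f(u),f(v)) = |u−v|² for all u,v ∈ ℝⁿ with |u−v|² ∈ ℚ, while φₙ(f(x),f(y)) ≠ |x−y|². -/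
/-- `φₙ((x₁,...,xₙ),(y₁,...,yₙ)) = (x₁−y₁)² + ... + (xₙ−yₙ)²` on `ℂⁿ`. -/
noncomputable def phi (n : ℕ) (x y : Fin n → ℂ) : ℂ := ∑ i, (x i - y i) ^ 2

open scoped Cardinal TensorProduct in
/-- Given embeddings of a field `k` in `ℝ` and in `ℂ`, both `ℝ` and `ℂ` embed in `ℂ` so that the
two composite embeddings of `k` agree. -/
theorem exists_amalgamation_real_complex {k : Type} [Field k] (u : k →+* ℝ) (v : k →+* ℂ) :
    ∃ (i : ℝ →+* ℂ) (j : ℂ →+* ℂ), i.comp u = j.comp v := by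
  let : Algebra k ℝ := u.toAlgebra
  let : Algebra k ℂ := v.toAlgebra
  obtain ⟨m, hm⟩ := Ideal.exists_maximal (ℝ ⊗[k] ℂ)
  let : Field ((ℝ ⊗[k] ℂ) ⧸ m) := Ideal.Quotient.field m
  let Ω := AlgebraicClosure ((ℝ ⊗[k] ℂ) ⧸ m)
  let q : ℝ ⊗[k] ℂ →+* Ω := (algebraMap _ Ω).comp (Ideal.Quotient.mk m)
  let i : ℝ →+* Ω := q.comp (Algebra.TensorProduct.includeLeft (R := k) (S := k)).toRingHom
  let j : ℂ →+* Ω := q.comp (Algebra.TensorProduct.includeRight (R := k)).toRingHom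
  have hij : i.comp u = j.comp v := by
    ext z
    have : (algebraMap k ℝ z) ⊗ₜ[k] (1 : ℂ) = (1 : ℝ) ⊗ₜ[k] (algebraMap k ℂ z) := by
      rw [Algebra.algebraMap_eq_smul_one, Algebra.algebraMap_eq_smul_one,
        TensorProduct.smul_tmul]
    exact congrArg q this
  have hT : #(ℝ ⊗[k] ℂ) ≤ 𝔠 := by
    have hs : Function.Surjective
        (fun l : List (ℝ × ℂ) => (l.map fun p => p.1 ⊗ₜ[k] p.2).sum) := by
      intro t
      induction t with
      | zero => exact ⟨[], rfl⟩
      | tmul x y => exact ⟨[(x, y)], by simp⟩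
      | add a b ha hb =>
        obtain ⟨l, rfl⟩ := ha
        obtain ⟨l', rfl⟩ := hb
        exact ⟨l ++ l', by simp⟩
    refine (Cardinal.mk_le_of_surjective hs).trans ?_
    rw [Cardinal.mk_list_eq_mk]
    simp [Cardinal.mk_real]
  have hL : #((ℝ ⊗[k] ℂ) ⧸ m) ≤ 𝔠 :=
    (Cardinal.mk_le_of_surjective Ideal.Quotient.mk_surjective).trans hT
  have hΩ : #Ω ≤ 𝔠 :=
    (Algebra.IsAlgebraic.cardinalMk_le_max ((ℝ ⊗[k] ℂ) ⧸ m) Ω).trans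
      (max_le hL Cardinal.aleph0_le_continuum)
  have hcard : #Ω = #ℂ := by
    rw [Cardinal.mk_complex]
    refine hΩ.antisymm ?_
    rw [← Cardinal.mk_complex]
    exact Cardinal.mk_le_of_injective j.injective
  have : CharZero Ω := charZero_of_injective_ringHom j.injective
  obtain ⟨e⟩ := IsAlgClosed.ringEquiv_of_equiv_of_charZero (K := Ω) (L := ℂ)
    (by rw [hcard, Cardinal.mk_complex]; exact Cardinal.aleph0_lt_continuum)
    (Cardinal.eq.1 hcard)
  refine ⟨e.toRingHom.comp i, e.toRingHom.comp j, ?_⟩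
  exact congrArg e.toRingHom.comp hij

/-- If a field `k` has embeddings in `ℝ` and `ℂ` with different values at `z`, some embedding of
`ℝ` in `ℂ` moves the image of `z` in `ℝ`. -/
theorem exists_ringHom_ne_of_field {k : Type} [Field k] (u : k →+* ℝ) (v : k →+* ℂ) (z : k)
    (hz : v z ≠ (u z : ℂ)) : ∃ σ : ℝ →+* ℂ, σ (u z) ≠ (u z : ℂ) := by
  obtain ⟨i, j, hij⟩ := exists_amalgamation_real_complex u v
  by_contra! H
  have h1 : i (u z) = j (v z) := RingHom.congr_fun hij z
  have h2 : j (u z : ℂ) = (u z : ℂ) := H (j.comp Complex.ofRealHom)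
  exact hz (j.injective (by rw [← h1, H i, h2]))

open Polynomial in
/-- Every irrational real number is moved by some ring homomorphism `ℝ → ℂ`. -/
theorem Irrational.exists_ringHom_ne {a : ℝ} (ha : Irrational a) :
    ∃ σ : ℝ →+* ℂ, σ a ≠ (a : ℂ) := by
  by_cases hint : IsIntegral ℚ a
  · have hirr := minpoly.irreducible hint
    have : Fact (Irreducible (minpoly ℚ a)) := ⟨hirr⟩
    obtain ⟨b, hb, hba⟩ : ∃ b : ℂ, aeval b (minpoly ℚ a) = 0 ∧ b ≠ a := by
      have hmin : minpoly ℚ (a : ℂ) = minpoly ℚ a :=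
        minpoly.algebraMap_eq (algebraMap ℝ ℂ).injective a
      have hintC : IsIntegral ℚ (a : ℂ) := hint.algebraMap (B := ℂ)
      have hmem : (a : ℂ) ∉ (⊥ : Subalgebra ℚ ℂ) := by
        rintro ⟨r, hr⟩
        exact ha ⟨r, by simpa using congrArg Complex.re hr⟩
      obtain ⟨b, hne, hb⟩ := (notMem_iff_exists_ne_and_isConjRoot
        (minpoly.irreducible hintC).separable (IsAlgClosed.splits _)).1 hmem
      exact ⟨b, hmin ▸ hb.aeval_eq_zero, hne.symm⟩
    let u : AdjoinRoot (minpoly ℚ a) →+* ℝ :=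
      AdjoinRoot.lift (algebraMap ℚ ℝ) a (minpoly.aeval ℚ a)
    let v : AdjoinRoot (minpoly ℚ a) →+* ℂ := AdjoinRoot.lift (algebraMap ℚ ℂ) b hb
    have hu : u (AdjoinRoot.root _) = a := AdjoinRoot.lift_root _
    have hv : v (AdjoinRoot.root _) = b := AdjoinRoot.lift_root _
    simpa only [hu] using
      exists_ringHom_ne_of_field u v (AdjoinRoot.root _) (by rwa [hu, hv])
  · have htr : Transcendental ℚ a := fun h => hint h.isIntegral
    have htr' : Transcendental ℚ ((-a : ℝ) : ℂ) := by
      intro h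
      have := (isAlgebraic_algebraMap_iff (R := ℚ) (S := ℝ) (A := ℂ)
        Complex.ofReal_injective).1 h
      exact htr (neg_neg a ▸ this.neg)
    let u : FractionRing ℚ[X] →+* ℝ :=
      IsFractionRing.lift (g := (aeval a : ℚ[X] →ₐ[ℚ] ℝ).toRingHom)
        (transcendental_iff_injective.1 htr)
    let v : FractionRing ℚ[X] →+* ℂ :=
      IsFractionRing.lift (g := (aeval ((-a : ℝ) : ℂ) : ℚ[X] →ₐ[ℚ] ℂ).toRingHom)
        (transcendental_iff_injective.1 htr')
    have hu : u (algebraMap ℚ[X] _ X) = a :=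
      (IsFractionRing.lift_algebraMap _ _).trans (aeval_X _)
    have hv : v (algebraMap ℚ[X] _ X) = ((-a : ℝ) : ℂ) :=
      (IsFractionRing.lift_algebraMap _ _).trans (aeval_X _)
    have hne : v (algebraMap ℚ[X] _ X) ≠ (u (algebraMap ℚ[X] _ X) : ℂ) := by
      rw [hu, hv]
      norm_cast
      exact fun h => ha.ne_zero (by linarith)
    simpa only [hu] using exists_ringHom_ne_of_field u v _ hne

/-- Applying a ring homomorphism `ℝ → ℂ` coordinatewise transforms `phi` accordingly. -/
theorem phi_map_ringHom {n : ℕ} (σ : ℝ →+* ℂ) (u v : EuclideanSpace ℝ (Fin n)) :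
    phi n (fun i => σ (u i)) (fun i => σ (v i)) = σ (dist u v ^ 2) := by
  rw [EuclideanSpace.dist_sq_eq]
  simp [phi, Real.dist_eq, sq_abs]

/-- If `x, y ∈ ℝⁿ` (`n ≥ 1`) and `|x−y|²` is not rational, then there exists
`f : ℝⁿ → ℂⁿ` that preserves all distances `√r` with rational `r ≥ 0` but does not
preserve the distance between `x` and `y`. -/
theorem stmt1 (n : ℕ) (hn : 1 ≤ n) (x y : EuclideanSpace ℝ (Fin n))
    (h : ¬ ∃ q : ℚ, (q : ℝ) = dist x y ^ 2) :
    ∃ f : EuclideanSpace ℝ (Fin n) → (Fin n → ℂ),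
      (∀ u v : EuclideanSpace ℝ (Fin n), (∃ q : ℚ, (q : ℝ) = dist u v ^ 2) →
        phi n (f u) (f v) = ((dist u v ^ 2 : ℝ) : ℂ)) ∧
      phi n (f x) (f y) ≠ ((dist x y ^ 2 : ℝ) : ℂ) := by
  obtain ⟨σ, hσ⟩ := Irrational.exists_ringHom_ne (a := dist x y ^ 2) h
  refine ⟨fun u i => σ (u i), ?_, ?_⟩
  · rintro u v ⟨q, hq⟩
    rw [phi_map_ringHom, ← hq]
    simp
  · rwa [phi_map_ringHom]
end

section
/- The set A₂(ℂ) of all positive real numbers d such that every unit-distance preserving map f : ℝ² → ℂ² also preserves distance d is contained in {d > 0 : d² ∈ ℚ}. -/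
/-- `φ₂((x₁,x₂),(y₁,y₂)) = (x₁−y₁)² + (x₂−y₂)²` on `ℂ²`. -/
noncomputable def phi2 (x y : Fin 2 → ℂ) : ℂ := (x 0 - y 0) ^ 2 + (x 1 - y 1) ^ 2

/-- `f : ℝ² → ℂ²` preserves distance `d ≥ 0` if `|x−y| = d` implies
`φ₂(f(x),f(y)) = d²` for all `x, y ∈ ℝ²`. -/
def PreservesDist (f : EuclideanSpace ℝ (Fin 2) → (Fin 2 → ℂ)) (d : ℝ) : Prop :=
  ∀ x y : EuclideanSpace ℝ (Fin 2), dist x y = d → phi2 (f x) (f y) = ((d ^ 2 : ℝ) : ℂ)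

/-- `A₂(ℂ)`: the set of all `d > 0` such that every unit-distance preserving map
`f : ℝ² → ℂ²` also preserves distance `d`. -/
def A2 : Set ℝ :=
  {d | 0 < d ∧ ∀ f : EuclideanSpace ℝ (Fin 2) → (Fin 2 → ℂ),
    PreservesDist f 1 → PreservesDist f d}

/-- A ring embedding of the polynomial ring on a transcendence basis of a field `E` into an
algebraically closed field extends to `E`. -/
theorem IsTranscendenceBasis.exists_ringHom_extending {ι k E M : Type*} [Field k] [Field E]
    [Field M] [Algebra k E] [IsAlgClosed M] {v : ι → E} (hv : IsTranscendenceBasis k v)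
    (g : MvPolynomial ι k →+* M) (hg : Function.Injective g) :
    ∃ σ : E →+* M, ∀ p, σ (MvPolynomial.aeval v p) = g p := by
  have := hv.isAlgebraic
  let h : Algebra.adjoin k (Set.range v) →+* M := g.comp hv.1.aevalEquiv.symm.toRingHom
  have hh : Function.Injective h := hg.comp hv.1.aevalEquiv.symm.injective
  let : Algebra (Algebra.adjoin k (Set.range v)) M := h.toAlgebra
  have : FaithfulSMul (Algebra.adjoin k (Set.range v)) M :=
    (faithfulSMul_iff_algebraMap_injective _ _).2 hh
  refine ⟨(IsAlgClosed.lift : E →ₐ[Algebra.adjoin k (Set.range v)] M).toRingHom, fun p ↦ ?_⟩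
  have key := (IsAlgClosed.lift : E →ₐ[Algebra.adjoin k (Set.range v)] M).commutes
    (hv.1.aevalEquiv p)
  rw [show algebraMap (Algebra.adjoin k (Set.range v)) E (hv.1.aevalEquiv p) =
    MvPolynomial.aeval v p from hv.1.algebraMap_aevalEquiv p] at key
  refine key.trans ?_
  change g (hv.1.aevalEquiv.symm (hv.1.aevalEquiv p)) = g p
  rw [AlgEquiv.symm_apply_apply]

/-- Every element of an algebraically closed field outside a given subfield `F` of characteristic
zero is moved by some endomorphism. -/
theorem IsAlgClosed.exists_ringHom_apply_ne (F : Type*) {E : Type*} [Field F] [CharZero F]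
    [Field E] [Algebra F E] [IsAlgClosed E] {z : E} (hz : z ∉ Set.range (algebraMap F E)) : ∃ σ : E →+* E, σ z ≠ z := by
  by_cases halg : IsAlgebraic F z
  · let K := algebraicClosure F E
    let z' : K := ⟨z, mem_algebraicClosure_iff.2 halg⟩
    obtain ⟨τ, hτ⟩ : ∃ τ : Gal(K/F), τ z' ≠ z' := by
      by_contra! hfix
      have : IsGalois F K := IsAlgClosure.isGalois F K
      obtain ⟨q, hq⟩ := (InfiniteGalois.mem_bot_iff_fixed (k := F) z').2 hfix
      exact hz ⟨q, congrArg (algebraMap K E) hq⟩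
    obtain ⟨s, hs⟩ := exists_isTranscendenceBasis K E
    obtain ⟨σ, hσ⟩ := hs.exists_ringHom_extending
      ((MvPolynomial.aeval ((↑) : s → E)).toRingHom.comp
        (MvPolynomial.map (τ : K →+* K)))
      (Function.Injective.comp (g := MvPolynomial.aeval ((↑) : s → E)) hs.1 (MvPolynomial.map_injective _ (RingHom.injective _)))
    refine ⟨σ, fun h ↦ hτ (Subtype.ext ?_)⟩
    have key := hσ (MvPolynomial.C z')
    simp only [RingHom.comp_apply, MvPolynomial.map_C, AlgHom.toRingHom_eq_coe, RingHom.coe_coe,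
      MvPolynomial.aeval_C] at key
    exact key.symm.trans h
  · obtain ⟨s, hzs, hs⟩ := exists_isTranscendenceBasis_superset (R := F) (s := {z})
      (algebraicIndependent_unique_type_iff.2 halg)
    have hX : Transcendental F (Polynomial.X + 1 : Polynomial F) :=
      Polynomial.transcendental _
        (by rw [← Polynomial.C_1, Polynomial.natDegree_X_add_C]; exact one_ne_zero)
        (by rw [← Polynomial.C_1, Polynomial.leadingCoeff_X_add_C]; exact one_mem _)
    have hw := hs.1.polynomial_aeval_of_transcendental (fun _ ↦ hX)
    obtain ⟨σ, hσ⟩ := hs.exists_ringHom_extending (MvPolynomial.aeval _).toRingHom hw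
    refine ⟨σ, fun h ↦ ?_⟩
    have key := hσ (MvPolynomial.X ⟨z, hzs rfl⟩)
    simp [h] at key

/-- `A₂(ℂ) ⊆ {d > 0 : d² ∈ ℚ}`. -/
theorem stmt2 : A2 ⊆ {d : ℝ | 0 < d ∧ ∃ q : ℚ, (q : ℝ) = d ^ 2} := by
  rintro d ⟨hd, h⟩
  refine ⟨hd, ?_⟩
  by_contra hq
  obtain ⟨σ, hσ⟩ := IsAlgClosed.exists_ringHom_apply_ne ℚ (z := ((d ^ 2 : ℝ) : ℂ)) (by
    rintro ⟨q, h⟩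
    refine hq ⟨q, ?_⟩
    rw [eq_ratCast] at h
    exact_mod_cast h)
  let f : EuclideanSpace ℝ (Fin 2) → Fin 2 → ℂ := fun x i ↦ σ (x i)
  have hf (x y : EuclideanSpace ℝ (Fin 2)) :
      phi2 (f x) (f y) = σ ((dist x y ^ 2 : ℝ) : ℂ) := by
    rw [EuclideanSpace.dist_eq, Real.sq_sqrt (by positivity)]
    simp [phi2, f, Fin.sum_univ_two, Real.dist_eq, sq_abs]
  have h1 : PreservesDist f 1 := fun x y hxy ↦ by simp [hf, hxy]
  have hdist : dist (EuclideanSpace.single 0 d : EuclideanSpace ℝ (Fin 2)) 0 = d := by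
    simp [abs_of_pos hd]
  have h2 := h f h1 _ _ hdist
  rw [hf, hdist] at h2
  exact hσ h2
end

section
/- Let K be a field that is an algebra over ℂ. If X, Y ∈ ℂ², ψ₂(X,Y) is a rational number, and X ≠ Y, then there exists a finite set S_XY with {X,Y} ⊆ S_XY ⊆ ℂ² such that every unit-distance preserving map f : S_XY → K² satisfies ψ₂(f(X),f(Y)) = ψ₂(X,Y) (computed in K via the algebra map) and f(X) ≠ f(Y). -/
/-- `ψ₂((x₁,x₂),(y₁,y₂)) = (x₁−y₁)² + (x₂−y₂)²` on `K²`. -/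
def psi2 (K : Type*) [Field K] (x y : Fin 2 → K) : K := (x 0 - y 0) ^ 2 + (x 1 - y 1) ^ 2

open Filter

/-- The filter of sets of maps `ℂ² → K²` containing all maps that preserve unit distance on some
fixed finite subset of `ℂ²`. -/
def unitFilter (K : Type*) [Field K] : Filter ((Fin 2 → ℂ) → (Fin 2 → K)) where
  sets := {R | ∃ S : Set (Fin 2 → ℂ), S.Finite ∧
    ∀ f : (Fin 2 → ℂ) → (Fin 2 → K),
      (∀ U ∈ S, ∀ V ∈ S, psi2 ℂ U V = 1 → psi2 K (f U) (f V) = 1) → f ∈ R}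
  univ_sets := ⟨∅, Set.finite_empty, fun _ _ => trivial⟩
  sets_of_superset := by
    rintro R R' ⟨S, hS, h⟩ hR
    exact ⟨S, hS, fun f hf => hR (h f hf)⟩
  inter_sets := by
    rintro R R' ⟨S, hS, h⟩ ⟨S', hS', h'⟩
    exact ⟨S ∪ S', hS.union hS', fun f hf =>
      ⟨h f fun U hU V hV => hf U (Or.inl hU) V (Or.inl hV),
        h' f fun U hU V hV => hf U (Or.inr hU) V (Or.inr hV)⟩⟩

/-- The value `q` of `ψ₂` is preserved by all maps preserving unit distance on a suitable finite
set (depending on the pair of points). -/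
def Preserved (K : Type*) [Field K] (q : ℚ) : Prop :=
  ∀ X Y : Fin 2 → ℂ, psi2 ℂ X Y = q → ∀ᶠ f in unitFilter K, psi2 K (f X) (f Y) = q

theorem preserved_one (K : Type*) [Field K] : Preserved K 1 := by
  intro X Y h
  refine ⟨{X, Y}, by simp, fun f hf => ?_⟩
  simpa using hf X (by simp) Y (by simp) (by simpa using h)

theorem eq_zero_of_orthogonal_of_isotropic {K : Type*} [Field K] {e₀ e₁ v₀ v₁ : K}
    (he : e₀ ^ 2 + e₁ ^ 2 ≠ 0) (hve : v₀ * e₀ + v₁ * e₁ = 0) (hv : v₀ ^ 2 + v₁ ^ 2 = 0) :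
    v₀ = 0 ∧ v₁ = 0 := by
  constructor
  · have : (e₀ ^ 2 + e₁ ^ 2) * v₀ ^ 2 = 0 := by
      linear_combination (v₀ * e₀ - v₁ * e₁) * hve + e₁ ^ 2 * hv
    simpa [he] using this
  · have : (e₀ ^ 2 + e₁ ^ 2) * v₁ ^ 2 = 0 := by
      linear_combination (v₁ * e₁ - v₀ * e₀) * hve + e₀ ^ 2 * hv
    simpa [he] using this

/-- Two points at the same distances from two fixed points coincide or are mirror images. -/
theorem eq_or_psi2_eq_of_psi2_eq {K : Type*} [Field K] [CharZero K] {a b c : K} (hb : b ≠ 0)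
    {A B C D : Fin 2 → K} (hAB : psi2 K A B = b) (hAC : psi2 K A C = a) (hAD : psi2 K A D = a)
    (hBC : psi2 K B C = c) (hBD : psi2 K B D = c) :
    C = D ∨ psi2 K C D = 4 * a - (a + b - c) ^ 2 / b := by
  unfold psi2 at *
  obtain ⟨e₀, he₀⟩ : ∃ e, e = B 0 - A 0 := ⟨_, rfl⟩
  obtain ⟨e₁, he₁⟩ : ∃ e, e = B 1 - A 1 := ⟨_, rfl⟩
  obtain ⟨p₀, hp₀⟩ : ∃ e, e = C 0 - A 0 := ⟨_, rfl⟩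
  obtain ⟨p₁, hp₁⟩ : ∃ e, e = C 1 - A 1 := ⟨_, rfl⟩
  obtain ⟨r₀, hr₀⟩ : ∃ e, e = D 0 - A 0 := ⟨_, rfl⟩
  obtain ⟨r₁, hr₁⟩ : ∃ e, e = D 1 - A 1 := ⟨_, rfl⟩
  have h1 : e₀ ^ 2 + e₁ ^ 2 = b := by subst he₀ he₁; linear_combination hAB
  have h2 : p₀ ^ 2 + p₁ ^ 2 = a := by subst hp₀ hp₁; linear_combination hAC
  have h3 : r₀ ^ 2 + r₁ ^ 2 = a := by subst hr₀ hr₁; linear_combination hAD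
  have h4 : 2 * (p₀ * e₀ + p₁ * e₁) = a + b - c := by
    subst hp₀ hp₁ he₀ he₁; linear_combination hAC + hAB - hBC
  have h5 : 2 * (r₀ * e₀ + r₁ * e₁) = a + b - c := by
    subst hr₀ hr₁ he₀ he₁; linear_combination hAD + hAB - hBD
  have h6 : (r₀ - p₀) * e₀ + (r₁ - p₁) * e₁ = 0 := by linear_combination (h5 - h4) / 2
  have h7 : (r₀ - p₀) * (r₀ + p₀) + (r₁ - p₁) * (r₁ + p₁) = 0 := by
    linear_combination h3 - h2
  by_cases hw : r₀ - p₀ = 0 ∧ r₁ - p₁ = 0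
  · left
    ext i
    fin_cases i
    · simp only [Fin.zero_eta]
      linear_combination -(hw.1 + hp₀ - hr₀)
    · simp only [Fin.mk_one]
      linear_combination -(hw.2 + hp₁ - hr₁)
  · right
    have hx : (r₀ + p₀) * e₁ - (r₁ + p₁) * e₀ = 0 := by
      by_contra hx
      apply hw
      constructor
      · apply (mul_eq_zero.1 (_ : (r₀ - p₀) * ((r₀ + p₀) * e₁ - (r₁ + p₁) * e₀) = 0)).resolve_right hx
        linear_combination e₁ * h7 - (r₁ + p₁) * h6
      · apply (mul_eq_zero.1 (_ : (r₁ - p₁) * ((r₀ + p₀) * e₁ - (r₁ + p₁) * e₀) = 0)).resolve_right hx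
        linear_combination (r₀ + p₀) * h6 - e₀ * h7
    have h8 : ((r₀ + p₀) ^ 2 + (r₁ + p₁) ^ 2) * b = (a + b - c) ^ 2 := by
      have h9 : (r₀ + p₀) * e₀ + (r₁ + p₁) * e₁ = a + b - c := by linear_combination (h4 + h5) / 2
      rw [← h9, ← h1]
      linear_combination ((r₀ + p₀) * e₁ - (r₁ + p₁) * e₀) * hx
    have h10 : (C 0 - D 0) ^ 2 + (C 1 - D 1) ^ 2 = (p₀ - r₀) ^ 2 + (p₁ - r₁) ^ 2 := by
      subst hp₀ hp₁ hr₀ hr₁; ring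
    rw [h10, ← h8, mul_div_cancel_right₀ _ hb]
    linear_combination 2 * h2 + 2 * h3

/-- If the values `a`, `b`, `c` are preserved then so is four times the squared height, over the
side `b`, of a triangle with squared sides `a`, `b`, `c`. -/
theorem Preserved.height {K : Type*} [Field K] [CharZero K] {a b c : ℚ} (ha : Preserved K a)
    (hb : Preserved K b) (hc : Preserved K c) (hb0 : b ≠ 0)
    (hT : 4 * a - (a + b - c) ^ 2 / b ≠ 0) :
    Preserved K (4 * a - (a + b - c) ^ 2 / b) := by
  generalize hTdef : 4 * a - (a + b - c) ^ 2 / b = T at *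
  have hbC : (b : ℂ) ≠ 0 := by exact_mod_cast hb0
  have hTC : (T : ℂ) ≠ 0 := by exact_mod_cast hT
  have hTC' : 4 * (a : ℂ) - (a + b - c) ^ 2 / b = T := by rw [← hTdef]; push_cast; ring
  have hTK : 4 * (a : K) - (a + b - c) ^ 2 / b = T := by rw [← hTdef]; push_cast; ring
  have weak : ∀ C D : Fin 2 → ℂ, psi2 ℂ C D = T →
      ∀ᶠ f in unitFilter K, f C = f D ∨ psi2 K (f C) (f D) = T := by
    intro C D h
    obtain ⟨β, hβ⟩ := IsAlgClosed.exists_pow_nat_eq (b : ℂ) two_pos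
    obtain ⟨θ, hθ⟩ := IsAlgClosed.exists_pow_nat_eq (T : ℂ) two_pos
    have hβ0 : β ≠ 0 := by rintro rfl; exact hbC (by simpa using hβ.symm)
    have hθ0 : θ ≠ 0 := by rintro rfl; exact hTC (by simpa using hθ.symm)
    obtain ⟨l, hl⟩ : ∃ l, l = (a + b - c) / (2 * β * θ) := ⟨_, rfl⟩
    obtain ⟨m, hm⟩ : ∃ m, m = l - β / θ := ⟨_, rfl⟩
    have hl2 : l ^ 2 * T = a - T / 4 := by
      have hl' : l * (2 * β * θ) = a + b - c := by rw [hl]; field_simp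
      have : ((a : ℂ) + b - c) ^ 2 / b = 4 * l ^ 2 * T := by
        rw [div_eq_iff hbC, ← hl', ← hθ, ← hβ]; ring
      linear_combination (-hTC' - this) / 4
    have hlm : (l - m) ^ 2 * T = b := by
      rw [hm, ← hθ, ← hβ]; field_simp; ring
    have hm2 : m ^ 2 * T = c - T / 4 := by
      have : 2 * l * (l - m) * T = a + b - c := by
        rw [hm, hl, ← hθ, ← hβ]; field_simp; ring
      linear_combination hl2 + hlm - this
    unfold psi2 at h
    filter_upwards [
      ha ![(C 0 + D 0) / 2 - l * (D 1 - C 1), (C 1 + D 1) / 2 + l * (D 0 - C 0)] C (by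
        simp [psi2]; linear_combination (1 / 4 + l ^ 2) * h + hl2),
      ha ![(C 0 + D 0) / 2 - l * (D 1 - C 1), (C 1 + D 1) / 2 + l * (D 0 - C 0)] D (by
        simp [psi2]; linear_combination (1 / 4 + l ^ 2) * h + hl2),
      hc ![(C 0 + D 0) / 2 - m * (D 1 - C 1), (C 1 + D 1) / 2 + m * (D 0 - C 0)] C (by
        simp [psi2]; linear_combination (1 / 4 + m ^ 2) * h + hm2),
      hc ![(C 0 + D 0) / 2 - m * (D 1 - C 1), (C 1 + D 1) / 2 + m * (D 0 - C 0)] D (by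
        simp [psi2]; linear_combination (1 / 4 + m ^ 2) * h + hm2),
      hb ![(C 0 + D 0) / 2 - l * (D 1 - C 1), (C 1 + D 1) / 2 + l * (D 0 - C 0)]
        ![(C 0 + D 0) / 2 - m * (D 1 - C 1), (C 1 + D 1) / 2 + m * (D 0 - C 0)] (by
        simp [psi2]; linear_combination (l - m) ^ 2 * h + hlm)] with f h1 h2 h3 h4 h5
    rw [← hTK]
    exact eq_or_psi2_eq_of_psi2_eq (by exact_mod_cast hb0) h5 h1 h2 h3 h4
  by_cases hT1 : T = 1
  · rw [hT1]; exact preserved_one K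
  intro C D h
  obtain ⟨x, hx⟩ : ∃ x : ℂ, x = 1 - 1 / (2 * T) := ⟨_, rfl⟩
  obtain ⟨y, hy⟩ := IsAlgClosed.exists_pow_nat_eq (1 - x ^ 2) two_pos
  have hx' : (2 - 2 * x) * T = 1 := by rw [hx]; field_simp; ring
  have h' := h
  unfold psi2 at h'
  filter_upwards [weak C D h,
    weak C ![C 0 + x * (D 0 - C 0) - y * (D 1 - C 1), C 1 + x * (D 1 - C 1) + y * (D 0 - C 0)] (by
      simp [psi2]; linear_combination h' + hy * ((D 0 - C 0) ^ 2 + (D 1 - C 1) ^ 2)),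
    preserved_one K D
      ![C 0 + x * (D 0 - C 0) - y * (D 1 - C 1), C 1 + x * (D 1 - C 1) + y * (D 0 - C 0)] (by
      simp [psi2]
      linear_combination (2 - 2 * x) * h' + hy * ((D 0 - C 0) ^ 2 + (D 1 - C 1) ^ 2) + hx')]
    with f h1 h2 h3
  rcases h1 with h1 | h1
  · exfalso
    rw [← h1] at h3
    rcases h2 with h2 | h2
    · rw [← h2] at h3
      simp [psi2] at h3
    · rw [h2] at h3
      exact hT1 (by exact_mod_cast h3)
  · exact h1

/-- The midpoint relation is detected by the values of `ψ₂`. -/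
theorem eq_two_mul_sub_of_psi2_eq {K : Type*} [Field K] [CharZero K] {r : K} (hr : r ≠ 0)
    {X M Y : Fin 2 → K} (hXM : psi2 K X M = r) (hMY : psi2 K M Y = r)
    (hXY : psi2 K X Y = 4 * r) : ∀ i, Y i = 2 * M i - X i := by
  unfold psi2 at *
  obtain ⟨h0, h1⟩ := eq_zero_of_orthogonal_of_isotropic (e₀ := M 0 - X 0) (e₁ := M 1 - X 1)
    (v₀ := Y 0 - 2 * M 0 + X 0) (v₁ := Y 1 - 2 * M 1 + X 1)
    (fun h => hr (by linear_combination h - hXM))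
    (by linear_combination (hXY + hXM - hMY) / 2 - 2 * hXM)
    (by linear_combination hXY + 4 * hXM - 2 * (hXY + hXM - hMY))
  intro i
  fin_cases i
  · simp only [Fin.zero_eta]; linear_combination h0
  · simp only [Fin.mk_one]; linear_combination h1

/-- The fourth vertex of a rhombus made of two equilateral triangles is detected by the values
of `ψ₂`. -/
theorem eq_add_sub_of_psi2_eq {K : Type*} [Field K] [CharZero K] {r : K} (hr : r ≠ 0)
    {X M P Q : Fin 2 → K} (hXM : psi2 K X M = r) (hXP : psi2 K X P = r) (hMP : psi2 K M P = r)
    (hMQ : psi2 K M Q = r) (hPQ : psi2 K P Q = r) (hXQ : psi2 K X Q = 3 * r) :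
    ∀ i, Q i = M i + P i - X i := by
  unfold psi2 at *
  obtain ⟨h0, h1⟩ := eq_zero_of_orthogonal_of_isotropic (e₀ := M 0 - X 0) (e₁ := M 1 - X 1)
    (v₀ := Q 0 - M 0 - P 0 + X 0) (v₁ := Q 1 - M 1 - P 1 + X 1)
    (fun h => hr (by linear_combination h - hXM))
    (by linear_combination (-hXP + hMP + hXQ - hMQ) / 2 - hXM)
    (by linear_combination hXQ + hXM + hXP - hXQ - hXM + hMQ - hXQ - hXP + hPQ + hXM + hXP - hMP)
  intro i
  fin_cases i
  · simp only [Fin.zero_eta]; linear_combination h0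
  · simp only [Fin.mk_one]; linear_combination h1

theorem Preserved.four_mul {K : Type*} [Field K] [CharZero K] {r : ℚ} (h : Preserved K r)
    (hr : r ≠ 0) : Preserved K (4 * r) := by
  have h3 : Preserved K (3 * r) := by
    have e : 4 * r - (r + r - r) ^ 2 / r = 3 * r := by field_simp; ring
    simpa only [e] using h.height h h hr (by rw [e]; positivity)
  intro X Y hXY
  have hrK : (r : K) ≠ 0 := by exact_mod_cast hr
  obtain ⟨s, hs⟩ := IsAlgClosed.exists_pow_nat_eq (3 : ℂ) two_pos
  obtain ⟨M, hM⟩ : ∃ M : Fin 2 → ℂ, M = ![(X 0 + Y 0) / 2, (X 1 + Y 1) / 2] := ⟨_, rfl⟩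
  obtain ⟨P, hP⟩ : ∃ P : Fin 2 → ℂ, P = ![X 0 + (Y 0 - X 0) / 4 - s / 4 * (Y 1 - X 1),
    X 1 + (Y 1 - X 1) / 4 + s / 4 * (Y 0 - X 0)] := ⟨_, rfl⟩
  obtain ⟨Q, hQ⟩ : ∃ Q : Fin 2 → ℂ, Q = ![X 0 + (Y 0 - X 0) * 3 / 4 - s / 4 * (Y 1 - X 1),
    X 1 + (Y 1 - X 1) * 3 / 4 + s / 4 * (Y 0 - X 0)] := ⟨_, rfl⟩
  unfold psi2 at hXY
  push_cast at hXY
  filter_upwards [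
    h X M (by simp [psi2, hM]; linear_combination hXY / 4),
    h M Y (by simp [psi2, hM]; linear_combination hXY / 4),
    h X P (by simp [psi2, hP]; linear_combination hXY / 4 + hs * ((X 0 - Y 0) ^ 2 + (X 1 - Y 1) ^ 2) / 16),
    h M P (by
      simp [psi2, hP, hM]; linear_combination hXY / 4 + hs * ((X 0 - Y 0) ^ 2 + (X 1 - Y 1) ^ 2) / 16),
    h M Q (by
      simp [psi2, hQ, hM]; linear_combination hXY / 4 + hs * ((X 0 - Y 0) ^ 2 + (X 1 - Y 1) ^ 2) / 16),
    h P Q (by simp [psi2, hP, hQ]; linear_combination hXY / 4),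
    h Q Y (by simp [psi2, hQ]; linear_combination hXY / 4 + hs * ((X 0 - Y 0) ^ 2 + (X 1 - Y 1) ^ 2) / 16),
    h3 X Q (by
      simp [psi2, hQ]; linear_combination 3 * hXY / 4 + hs * ((X 0 - Y 0) ^ 2 + (X 1 - Y 1) ^ 2) / 16),
    h3 P Y (by
      simp [psi2, hP]; linear_combination 3 * hXY / 4 + hs * ((X 0 - Y 0) ^ 2 + (X 1 - Y 1) ^ 2) / 16)]
    with f hXM hMY hXP hMP hMQ hPQ hQY hXQ hPY
  push_cast at hXQ hPY ⊢
  have comm : ∀ U V : Fin 2 → K, psi2 K U V = psi2 K V U := fun U V => by unfold psi2; ring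
  have e1 := eq_add_sub_of_psi2_eq hrK hXM hXP hMP hMQ hPQ hXQ
  have e2 := eq_add_sub_of_psi2_eq hrK (by rwa [comm]) hPQ hMQ hMY hQY hPY
  unfold psi2 at hXM ⊢
  rw [e2, e2, e1, e1]
  linear_combination 4 * hXM

theorem Preserved.inv {K : Type*} [Field K] [CharZero K] {k : ℚ} (h : Preserved K k)
    (hk : k ≠ 0) : Preserved K k⁻¹ := by
  have h1 := preserved_one K
  by_cases h4 : 4 - k⁻¹ = 0
  · have : k⁻¹ = 4 * 1 := by linear_combination -h4
    rw [this]
    exact h1.four_mul one_ne_zero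
  · have e : 4 * 1 - (1 + k - k) ^ 2 / k = 4 - k⁻¹ := by field_simp; ring
    have h2 : Preserved K (4 - k⁻¹) := by
      simpa only [e] using h1.height h h hk (by rwa [e])
    have e' : 4 * 1 - (1 + (4 - k⁻¹) - 1) ^ 2 / (4 - k⁻¹) = k⁻¹ := by
      rw [add_sub_cancel_left, sq, mul_div_cancel_right₀ _ h4]; ring
    simpa only [e'] using h1.height h2 h1 h4 (by rw [e']; exact inv_ne_zero hk)

theorem Preserved.sub {K : Type*} [Field K] [CharZero K] {a b : ℚ} (ha : Preserved K a)
    (hb : Preserved K b) (ha0 : a ≠ 0) (hb0 : b ≠ 0) (hab : a - b ≠ 0) :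
    Preserved K (a - b) := by
  have h4 : Preserved K (a / 4) := by
    have := ((ha.inv ha0).four_mul (inv_ne_zero ha0)).inv (by positivity)
    rwa [show (4 * a⁻¹)⁻¹ = a / 4 by field_simp] at this
  have e : 4 * (a / 4) - (a / 4 + b - a / 4) ^ 2 / b = a - b := by field_simp; ring
  simpa only [e] using h4.height hb h4 hb0 (by rwa [e])

theorem Preserved.neg {K : Type*} [Field K] [CharZero K] {b : ℚ} (hb : Preserved K b)
    (hb0 : b ≠ 0) : Preserved K (-b) := by
  have h3 := (hb.four_mul hb0).sub hb (by positivity) hb0 (by ring_nf; positivity)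
  have h2 := h3.sub hb (by ring_nf; positivity) hb0 (by ring_nf; positivity)
  have e : b - (4 * b - b - b) = -b := by ring
  simpa only [e] using hb.sub h2 hb0 (by ring_nf; positivity) (by rw [e]; exact neg_ne_zero.2 hb0)

theorem Preserved.succ_mul {K : Type*} [Field K] [CharZero K] {b : ℚ} (hb : Preserved K b)
    (hb0 : b ≠ 0) (n : ℕ) : Preserved K ((n + 1) * b) := by
  induction n with
  | zero => simpa using hb
  | succ n ih =>
    have e : (n + 1) * b - -b = ((n + 1 : ℕ) + 1) * b := by push_cast; ring
    have := ih.sub (hb.neg hb0) (by positivity) (neg_ne_zero.2 hb0) (by rw [e]; positivity)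
    rwa [e] at this

/-- Every nonzero rational value of `ψ₂` is preserved. -/
theorem preserved_of_ne_zero (K : Type*) [Field K] [CharZero K] {q : ℚ} (hq : q ≠ 0) :
    Preserved K q := by
  have pos : ∀ q : ℚ, 0 < q → Preserved K q := by
    intro q hq
    obtain ⟨m, hm⟩ := Nat.exists_eq_succ_of_ne_zero (Int.natAbs_ne_zero.2 (Rat.num_ne_zero.2 hq.ne'))
    obtain ⟨d, hd⟩ := Nat.exists_eq_succ_of_ne_zero q.den_ne_zero
    have h1 := (preserved_one K).succ_mul one_ne_zero d
    have h2 := (h1.inv (by positivity)).succ_mul (by positivity) m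
    convert h2 using 1
    have hm' : q.num = m + 1 := by have := Rat.num_pos.2 hq; omega
    rw [← Rat.num_div_den q, hm', hd]
    push_cast
    ring
  rcases hq.lt_or_gt with h | h
  · simpa using (pos (-q) (by linarith)).neg (by simpa using hq)
  · exact pos q h

/-- Distinct points on an isotropic line have distinct images on an isotropic line. -/
theorem eventually_psi2_eq_zero_and_ne (K : Type*) [Field K] [CharZero K] {X Y : Fin 2 → ℂ}
    (h : psi2 ℂ X Y = 0) (hXY : X ≠ Y) :
    ∀ᶠ f in unitFilter K, psi2 K (f X) (f Y) = 0 ∧ f X ≠ f Y := by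
  unfold psi2 at h
  have h0 : Y 0 - X 0 ≠ 0 := by
    intro h0
    have h1 : Y 1 - X 1 = 0 := by
      rw [← sq_eq_zero_iff]; linear_combination h - (Y 0 - X 0) * h0
    apply hXY
    ext i
    fin_cases i
    · simp only [Fin.zero_eta]; linear_combination -h0
    · simp only [Fin.mk_one]; linear_combination -h1
  obtain ⟨t, ht⟩ : ∃ t, t * (Y 0 - X 0) = 1 := ⟨_, inv_mul_cancel₀ h0⟩
  obtain ⟨a₀, ha₀⟩ : ∃ a, a = t / 4 + 2 * (Y 0 - X 0) := ⟨_, rfl⟩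
  obtain ⟨a₁, ha₁⟩ : ∃ a, a = (2 - t ^ 2 / 4) * (Y 1 - X 1) := ⟨_, rfl⟩
  have haa : a₀ ^ 2 + a₁ ^ 2 = 2 := by
    rw [ha₀, ha₁]
    linear_combination (2 - t ^ 2 / 4) ^ 2 * h +
      (1 + (1 - t ^ 2 / 16) * (t * (Y 0 - X 0) + 1)) * ht
  have had : a₀ * (Y 0 - X 0) + a₁ * (Y 1 - X 1) = 1 / 2 := by
    rw [ha₀, ha₁]
    linear_combination (2 - t ^ 2 / 4) * h + (1 / 4 + (t * (Y 0 - X 0) + 1) / 4) * ht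
  filter_upwards [
    preserved_of_ne_zero K (q := 2) (by norm_num) X ![X 0 + a₀, X 1 + a₁] (by
      simp [psi2]; linear_combination haa),
    preserved_of_ne_zero K (q := 2) (by norm_num) ![X 0 + a₀, X 1 + a₁]
      ![X 0 + 2 * a₀, X 1 + 2 * a₁] (by simp [psi2]; linear_combination haa),
    preserved_of_ne_zero K (q := 8) (by norm_num) X ![X 0 + 2 * a₀, X 1 + 2 * a₁] (by
      simp [psi2]; linear_combination 4 * haa),
    preserved_of_ne_zero K (q := 1) (by norm_num) Y ![X 0 + a₀, X 1 + a₁] (by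
      simp [psi2]; linear_combination haa - 2 * had + h),
    preserved_of_ne_zero K (q := 6) (by norm_num) Y ![X 0 + 2 * a₀, X 1 + 2 * a₁] (by
      simp [psi2]; linear_combination 4 * haa - 4 * had + h)] with f hXA hAC hXC hYA hYC
  push_cast at hXA hAC hXC hYA hYC
  have e := eq_two_mul_sub_of_psi2_eq two_ne_zero hXA hAC (by rw [hXC]; norm_num)
  constructor
  · unfold psi2 at *
    rw [e, e] at hYC
    linear_combination 2 * hYA + 2 * hXA - hYC
  · intro hf
    rw [hf, hYA] at hXA
    norm_num at hXA

/-- Let `K` be a field extending `ℂ`. If `X, Y ∈ ℂ²`, `ψ₂(X,Y)` is rational and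
`X ≠ Y`, then there is a finite set `S` with `{X,Y} ⊆ S ⊆ ℂ²` such that every
unit-distance preserving map `f : S → K²` satisfies `ψ₂(f(X),f(Y)) = ψ₂(X,Y)` and
`f(X) ≠ f(Y)`. -/
theorem stmt16 (K : Type*) [Field K] [Algebra ℂ K] (X Y : Fin 2 → ℂ)
    (hq : ∃ q : ℚ, (q : ℂ) = psi2 ℂ X Y) (hXY : X ≠ Y) :
    ∃ S : Set (Fin 2 → ℂ), S.Finite ∧ X ∈ S ∧ Y ∈ S ∧
      ∀ f : (Fin 2 → ℂ) → (Fin 2 → K),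
        (∀ U ∈ S, ∀ V ∈ S, psi2 ℂ U V = 1 → psi2 K (f U) (f V) = 1) →
        psi2 K (f X) (f Y) = algebraMap ℂ K (psi2 ℂ X Y) ∧ f X ≠ f Y := by
  have : CharZero K := charZero_of_injective_algebraMap (algebraMap ℂ K).injective
  obtain ⟨q, hq⟩ := hq
  suffices h : ∀ᶠ f in unitFilter K,
      psi2 K (f X) (f Y) = algebraMap ℂ K (psi2 ℂ X Y) ∧ f X ≠ f Y by
    obtain ⟨S, hS, h⟩ := h
    exact ⟨S ∪ {X, Y}, hS.union (by simp), by simp, by simp,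
      fun f hf => h f fun U hU V hV => hf U (Or.inl hU) V (Or.inl hV)⟩
  by_cases hq0 : q = 0
  · subst hq0
    rw [← hq]
    simpa using eventually_psi2_eq_zero_and_ne K (by simpa using hq.symm) hXY
  · filter_upwards [preserved_of_ne_zero K hq0 X Y hq.symm] with f hf
    refine ⟨by rw [hf, ← hq, map_ratCast], fun he => hq0 ?_⟩
    simp [psi2, he] at hf
    exact_mod_cast hf.symm
end
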